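/- (Uniqueness of the DCF stationary law) For every n ≥ 2, the Ewens measure π_S⁽ⁿ⁾ is the unique stationary probability measure of the DCF⁽ⁿ⁾ chain on 𝒫ₙ, i.e. the unique probability vector π on 𝒫ₙ with Σ_ℓ π(ℓ)K⁽ⁿ⁾(ℓ,ℓ') = π(ℓ') for all ℓ' ∈ 𝒫ₙ. -/

import Mathlib

open MeasureTheory ENNReal Filter Set

noncomputable section

/-- The set `𝒫ₙ` of integer partitions of `n`, as nonincreasing sequences. -/
def PartN (n : ℕ) : Set (ℕ → ℕ) :=
  {l | Antitone l ∧ ∑' i, (l i : ℝ≥0∞) = n}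

/-- `N_ℓ(k)`, the number of parts of `ℓ` equal to `k`. -/
def typeCount (l : ℕ → ℕ) (k : ℕ) : ℕ := Nat.card {i | l i = k}

/-- `N_ℓ`, the total number of nonzero parts of `ℓ`. -/
def numParts (l : ℕ → ℕ) : ℕ := Nat.card {i | l i ≠ 0}

/-- `ℓ'` is obtained from `ℓ` by merging a part of size `j` and a part of size
`k` (`j ≠ k`), expressed through the type counts. -/
def MergeRel (j k : ℕ) (l l' : ℕ → ℕ) : Prop :=
  typeCount l j = typeCount l' j + 1 ∧ typeCount l k = typeCount l' k + 1 ∧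
  typeCount l' (j + k) = typeCount l (j + k) + 1 ∧
  ∀ q, q ∉ ({j, k, j + k} : Set ℕ) → typeCount l' q = typeCount l q

/-- `ℓ'` is obtained from `ℓ` by merging two parts of equal size `j`. -/
def EqMergeRel (j : ℕ) (l l' : ℕ → ℕ) : Prop :=
  typeCount l j = typeCount l' j + 2 ∧ typeCount l' (2 * j) = typeCount l (2 * j) + 1 ∧
  ∀ q, q ∉ ({j, 2 * j} : Set ℕ) → typeCount l' q = typeCount l q

open Classical in
/-- The transition matrix `K⁽ⁿ⁾` of the discrete coagulation-fragmentation chain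
DCF⁽ⁿ⁾ (the cycle-type evolution of random transpositions on `Sₙ`): merge and
split rates as in the paper, all other entries being `0`. -/
def Kmat (n : ℕ) (l l' : ℕ → ℕ) : ℝ :=
  (∑ j ∈ Finset.range (n + 1), ∑ k ∈ Finset.range (n + 1),
    ((if 1 ≤ j ∧ j < k ∧ MergeRel j k l l' then
        2 * (j : ℝ) * (k : ℝ) * (typeCount l j : ℝ) * (typeCount l k : ℝ) /
          ((n : ℝ) * ((n : ℝ) - 1)) else 0)
     + (if 1 ≤ j ∧ j < k ∧ MergeRel j k l' l then
        2 * ((j : ℝ) + (k : ℝ)) * (typeCount l (j + k) : ℝ) /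
          ((n : ℝ) * ((n : ℝ) - 1)) else 0)))
  + ∑ j ∈ Finset.range (n + 1),
    ((if 1 ≤ j ∧ 2 * j ≤ n ∧ EqMergeRel j l l' then
        (j : ℝ) ^ 2 * (typeCount l j : ℝ) * ((typeCount l j : ℝ) - 1) /
          ((n : ℝ) * ((n : ℝ) - 1)) else 0)
     + (if 1 ≤ j ∧ 2 * j ≤ n ∧ EqMergeRel j l' l then
        2 * (j : ℝ) * (typeCount l (2 * j) : ℝ) / ((n : ℝ) * ((n : ℝ) - 1)) else 0))

/-- The Ewens measure `π_S⁽ⁿ⁾(ℓ) = (∏_{k=1}^n k^{N_ℓ(k)} N_ℓ(k)!)⁻¹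
  = (∏ᵢ ℓᵢ ∏_{k=1}^n N_ℓ(k)!)⁻¹` on `𝒫ₙ`. -/
def ewens (n : ℕ) (l : ℕ → ℕ) : ℝ :=
  (∏ k ∈ Finset.Icc 1 n,
    ((k : ℝ) ^ typeCount l k * (Nat.factorial (typeCount l k) : ℝ)))⁻¹

/-- The multiset `t` arises from `s` by replacing the parts `j`, `k` with `j + k`. -/
abbrev PartsMerge (j k : ℕ) (s t : Multiset ℕ) : Prop := s + {j + k} = t + {j, k}

/-- The reciprocal of the Ewens weight of a multiset of parts of size at most `n`. -/
def partsWeight (n : ℕ) (s : Multiset ℕ) : ℝ :=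
  ∏ k ∈ Finset.Icc 1 n, ((k : ℝ) ^ s.count k * (Nat.factorial (s.count k) : ℝ))

/-- The unnormalized rate of merging an ordered pair of parts of sizes `j`, `k`. -/
def mergeRate (j k : ℕ) (s : Multiset ℕ) : ℝ :=
  (j : ℝ) * k * (s.count j : ℝ) * ((s.erase j).count k : ℝ)

/-- The unnormalized rate of splitting a part of size `j + k` into the ordered pair `(j, k)`. -/
def splitRate (j k : ℕ) (s : Multiset ℕ) : ℝ :=
  ((j : ℝ) + k) * (s.count (j + k) : ℝ)

/-- The total unnormalized transition rate between multisets of parts. -/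
def partsRate (n : ℕ) (s t : Multiset ℕ) : ℝ :=
  ∑ j ∈ Finset.Icc 1 n, ∑ k ∈ Finset.Icc 1 n,
    ((if PartsMerge j k s t then mergeRate j k s else 0) +
      (if PartsMerge j k t s then splitRate j k s else 0))

lemma partsWeight_pos (n : ℕ) (s : Multiset ℕ) : 0 < partsWeight n s := by
  refine Finset.prod_pos fun k hk => ?_
  have : 0 < k := (Finset.mem_Icc.1 hk).1
  positivity

lemma partsWeight_cons {n a : ℕ} (ha : 1 ≤ a) (han : a ≤ n) (s : Multiset ℕ) :
    partsWeight n (a ::ₘ s) = a * (s.count a + 1) * partsWeight n s := by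
  have hmem : a ∈ Finset.Icc 1 n := Finset.mem_Icc.2 ⟨ha, han⟩
  unfold partsWeight
  rw [← Finset.mul_prod_erase _ _ hmem, ← Finset.mul_prod_erase _ _ hmem]
  have hrest : ∀ k ∈ (Finset.Icc 1 n).erase a,
      ((k : ℝ) ^ (a ::ₘ s).count k * (Nat.factorial ((a ::ₘ s).count k) : ℝ)) =
        (k : ℝ) ^ s.count k * (Nat.factorial (s.count k) : ℝ) := by
    intro k hk
    rw [Multiset.count_cons_of_ne (Finset.ne_of_mem_erase hk)]
  rw [Finset.prod_congr rfl hrest, Multiset.count_cons_self, Nat.factorial_succ]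
  push_cast
  ring

lemma PartsMerge.exists_eq_cons {j k : ℕ} {s t : Multiset ℕ} (hj : 1 ≤ j) (hk : 1 ≤ k)
    (h : PartsMerge j k s t) :
    ∃ u, s = j ::ₘ k ::ₘ u ∧ t = (j + k) ::ₘ u := by
  have hmem : j + k ∈ t + {j, k} := h ▸ by simp
  have ht : j + k ∈ t := by
    rcases Multiset.mem_add.1 hmem with h | h
    · exact h
    · simp at h; omega
  obtain ⟨u, rfl⟩ := Multiset.exists_cons_of_mem ht
  refine ⟨u, ?_, rfl⟩
  have : s + {j + k} = (j ::ₘ k ::ₘ u) + {j + k} := by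
    rw [h]
    ext q
    simp only [Multiset.count_add, Multiset.count_cons, Multiset.insert_eq_cons,
      Multiset.count_singleton]
    omega
  exact add_right_cancel this

lemma partsMerge_cons (j k : ℕ) (u : Multiset ℕ) :
    PartsMerge j k (j ::ₘ k ::ₘ u) ((j + k) ::ₘ u) := by
  ext q
  simp only [Multiset.count_add, Multiset.count_cons, Multiset.insert_eq_cons,
    Multiset.count_singleton]
  omega

lemma mergeRate_cons_cons (j k : ℕ) (u : Multiset ℕ) :
    mergeRate j k (j ::ₘ k ::ₘ u) = j * k * ((k ::ₘ u).count j + 1) * (u.count k + 1) := by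
  simp [mergeRate]

lemma PartsMerge.detailed_balance {n j k : ℕ} {s t : Multiset ℕ} (hj : 1 ≤ j) (hk : 1 ≤ k)
    (ht : ∀ a ∈ t, a ≤ n) (h : PartsMerge j k s t) :
    (partsWeight n s)⁻¹ * mergeRate j k s = (partsWeight n t)⁻¹ * splitRate j k t := by
  obtain ⟨u, rfl, rfl⟩ := h.exists_eq_cons hj hk
  have hn : j + k ≤ n := ht _ (by simp)
  have hu := (partsWeight_pos n u).ne'
  have hj' : (0 : ℝ) < j := by exact_mod_cast hj
  have hk' : (0 : ℝ) < k := by exact_mod_cast hk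
  rw [mergeRate_cons_cons, partsWeight_cons hj (by omega), partsWeight_cons hk (by omega),
    partsWeight_cons (by omega) hn, splitRate, Multiset.count_cons_self]
  push_cast
  field_simp

lemma partsRate_detailed_balance {n : ℕ} (p q : n.Partition) :
    (partsWeight n p.parts)⁻¹ * partsRate n p.parts q.parts =
      (partsWeight n q.parts)⁻¹ * partsRate n q.parts p.parts := by
  unfold partsRate
  simp only [Finset.mul_sum]
  refine Finset.sum_congr rfl fun j hj => Finset.sum_congr rfl fun k hk => ?_
  have hj := (Finset.mem_Icc.1 hj).1
  have hk := (Finset.mem_Icc.1 hk).1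
  rw [mul_add, mul_add, add_comm]
  congr 1
  · split_ifs with h
    · exact (h.detailed_balance hj hk fun _ => p.le_of_mem_parts).symm
    · simp
  · split_ifs with h
    · exact h.detailed_balance hj hk fun _ => q.le_of_mem_parts
    · simp

lemma partsRate_nonneg (n : ℕ) (s t : Multiset ℕ) : 0 ≤ partsRate n s t := by
  refine Finset.sum_nonneg fun j _ => Finset.sum_nonneg fun k _ => add_nonneg ?_ ?_
  · split_ifs <;> simp only [mergeRate, le_refl]; positivity
  · split_ifs <;> simp only [splitRate, le_refl]; positivity

lemma partsRate_pos_of_merge {n j k : ℕ} (hj : 1 ≤ j) (hk : 1 ≤ k) (hn : j + k ≤ n)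
    (u : Multiset ℕ) : 0 < partsRate n (j ::ₘ k ::ₘ u) ((j + k) ::ₘ u) := by
  have hnn : ∀ a b : ℕ, 0 ≤ ((if PartsMerge a b (j ::ₘ k ::ₘ u) ((j + k) ::ₘ u)
      then mergeRate a b (j ::ₘ k ::ₘ u) else 0) +
      (if PartsMerge a b ((j + k) ::ₘ u) (j ::ₘ k ::ₘ u)
        then splitRate a b (j ::ₘ k ::ₘ u) else 0) : ℝ) := by
    intro a b
    refine add_nonneg ?_ ?_
    · split_ifs <;> simp only [mergeRate, le_refl]; positivity
    · split_ifs <;> simp only [splitRate, le_refl]; positivity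
  refine Finset.sum_pos' (fun a _ => Finset.sum_nonneg fun b _ => hnn a b)
    ⟨j, Finset.mem_Icc.2 ⟨hj, by omega⟩, ?_⟩
  refine Finset.sum_pos' (fun b _ => hnn j b) ⟨k, Finset.mem_Icc.2 ⟨hk, by omega⟩, ?_⟩
  rw [if_pos (partsMerge_cons j k u), mergeRate_cons_cons]
  have hj' : (0 : ℝ) < j := by exact_mod_cast hj
  have hk' : (0 : ℝ) < k := by exact_mod_cast hk
  refine add_pos_of_pos_of_nonneg (by positivity) ?_
  split_ifs <;> simp only [splitRate, le_refl]; positivity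

lemma sum_partsMerge_mergeRate {n : ℕ} (p : n.Partition) {j k : ℕ} (hj : 1 ≤ j) (hk : 1 ≤ k) :
    ∑ q : n.Partition, (if PartsMerge j k p.parts q.parts then mergeRate j k p.parts else 0) =
      mergeRate j k p.parts := by
  by_cases h : j ∈ p.parts ∧ k ∈ p.parts.erase j
  · obtain ⟨hjp, hkp⟩ := h
    obtain ⟨u, hu⟩ := Multiset.exists_cons_of_mem hkp
    have hp : p.parts = j ::ₘ k ::ₘ u := by rw [← hu, Multiset.cons_erase hjp]
    let q : n.Partition := ⟨(j + k) ::ₘ u, by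
      intro i hi
      rcases Multiset.mem_cons.1 hi with rfl | hi
      · omega
      · exact p.parts_pos (by rw [hp]; simp [hi]), by
      rw [← p.parts_sum, hp]; simp [add_assoc]⟩
    rw [Finset.sum_eq_single q]
    · rw [if_pos]
      rw [hp]
      exact partsMerge_cons j k u
    · intro r _ hr
      rw [if_neg]
      intro hm
      refine hr (Nat.Partition.ext (add_right_cancel (b := {j, k}) ?_))
      rw [← hm, hp]
      exact partsMerge_cons j k u
    · simp
  · have h0 : mergeRate j k p.parts = 0 := by
      unfold mergeRate
      by_cases hjp : j ∈ p.parts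
      · rw [Multiset.count_eq_zero_of_notMem (fun hk => h ⟨hjp, hk⟩)]; simp
      · rw [Multiset.count_eq_zero_of_notMem hjp]; simp
    simp [h0]

lemma sum_partsMerge_splitRate {n : ℕ} (p : n.Partition) {j k : ℕ} (hj : 1 ≤ j) (hk : 1 ≤ k) :
    ∑ q : n.Partition, (if PartsMerge j k q.parts p.parts then splitRate j k p.parts else 0) =
      splitRate j k p.parts := by
  by_cases h : j + k ∈ p.parts
  · obtain ⟨u, hp⟩ := Multiset.exists_cons_of_mem h
    let q : n.Partition := ⟨j ::ₘ k ::ₘ u, by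
      intro i hi
      rcases Multiset.mem_cons.1 hi with rfl | hi
      · omega
      rcases Multiset.mem_cons.1 hi with rfl | hi
      · omega
      · exact p.parts_pos (by rw [hp]; simp [hi]), by
      rw [← p.parts_sum, hp]; simp [add_assoc]⟩
    rw [Finset.sum_eq_single q]
    · rw [if_pos]
      rw [hp]
      exact partsMerge_cons j k u
    · intro r _ hr
      rw [if_neg]
      intro hm
      refine hr (Nat.Partition.ext (add_right_cancel (b := {j + k}) ?_))
      rw [hm, hp]
      exact (partsMerge_cons j k u).symm
    · simp
  · have h0 : splitRate j k p.parts = 0 := by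
      simp [splitRate, Multiset.count_eq_zero_of_notMem h]
    simp [h0]

lemma Nat.Partition.sum_Icc_mul_count {n : ℕ} (p : n.Partition) :
    ∑ k ∈ Finset.Icc 1 n, (k : ℝ) * p.parts.count k = n := by
  have h := Finset.sum_multiset_count_of_subset p.parts (Finset.Icc 1 n) (by
    intro a ha
    rw [Multiset.mem_toFinset] at ha
    exact Finset.mem_Icc.2 ⟨p.parts_pos ha, p.le_of_mem_parts ha⟩)
  rw [p.parts_sum] at h
  conv_rhs => rw [h]
  push_cast
  exact Finset.sum_congr rfl fun k _ => by simp [mul_comm]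

lemma sum_mergeRate {n : ℕ} (p : n.Partition) :
    ∑ j ∈ Finset.Icc 1 n, ∑ k ∈ Finset.Icc 1 n, mergeRate j k p.parts =
      (n : ℝ) ^ 2 - ∑ j ∈ Finset.Icc 1 n, (j : ℝ) ^ 2 * p.parts.count j := by
  have hterm : ∀ j k : ℕ, mergeRate j k p.parts =
      (j * p.parts.count j) * (k * p.parts.count k) -
        if k = j then (j : ℝ) ^ 2 * p.parts.count j else 0 := by
    intro j k
    unfold mergeRate
    split_ifs with h
    · subst h
      by_cases hc : p.parts.count k = 0
      · simp [hc]
      · rw [Multiset.count_erase_self, Nat.cast_sub (by omega)]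
        push_cast
        ring
    · rw [Multiset.count_erase_of_ne h]
      ring
  simp only [hterm, Finset.sum_sub_distrib]
  rw [← Finset.sum_mul_sum, p.sum_Icc_mul_count, sq]
  congr 1
  exact Finset.sum_congr rfl fun j hj => by rw [Finset.sum_ite_eq', if_pos hj]

lemma sum_splitRate {n : ℕ} (p : n.Partition) :
    ∑ j ∈ Finset.Icc 1 n, ∑ k ∈ Finset.Icc 1 n, splitRate j k p.parts =
      ∑ m ∈ Finset.Icc 1 n, (m : ℝ) * (m - 1) * p.parts.count m := by
  have hinner : ∀ j ∈ Finset.Icc 1 n, ∑ k ∈ Finset.Icc 1 n, splitRate j k p.parts =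
      ∑ m ∈ Finset.Icc 1 n, if j < m then (m : ℝ) * p.parts.count m else 0 := by
    intro j _
    rw [← Finset.sum_filter]
    have hsub : (Finset.Icc 1 n).filter (j < ·) ⊆ (Finset.Icc 1 n).map (addLeftEmbedding j) := by
      intro m hm
      simp only [Finset.mem_filter, Finset.mem_Icc, Finset.mem_map, addLeftEmbedding_apply] at hm ⊢
      exact ⟨m - j, by omega, by omega⟩
    rw [Finset.sum_subset hsub, Finset.sum_map]
    · simp [splitRate]
    · intro m hm hm'
      simp only [Finset.mem_filter, Finset.mem_Icc, Finset.mem_map, addLeftEmbedding_apply]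
        at hm hm'
      have : m ∉ p.parts := fun h => by
        have := p.le_of_mem_parts h
        omega
      simp [Multiset.count_eq_zero_of_notMem this]
  rw [Finset.sum_congr rfl hinner, Finset.sum_comm]
  refine Finset.sum_congr rfl fun m hm => ?_
  have hm := Finset.mem_Icc.1 hm
  rw [← Finset.sum_filter, Finset.sum_const]
  have : (Finset.Icc 1 n).filter (· < m) = Finset.Ico 1 m := by
    ext x
    simp only [Finset.mem_filter, Finset.mem_Icc, Finset.mem_Ico]
    omega
  rw [this, Nat.card_Ico, nsmul_eq_mul, Nat.cast_sub hm.1]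
  push_cast
  ring

lemma sum_partsRate {n : ℕ} (p : n.Partition) :
    ∑ q : n.Partition, partsRate n p.parts q.parts = n * (n - 1) := by
  unfold partsRate
  rw [Finset.sum_comm]
  have : ∀ j ∈ Finset.Icc 1 n, ∑ q : n.Partition, ∑ k ∈ Finset.Icc 1 n,
      ((if PartsMerge j k p.parts q.parts then mergeRate j k p.parts else 0) +
        (if PartsMerge j k q.parts p.parts then splitRate j k p.parts else 0)) =
      ∑ k ∈ Finset.Icc 1 n, (mergeRate j k p.parts + splitRate j k p.parts) := by
    intro j hj
    rw [Finset.sum_comm]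
    refine Finset.sum_congr rfl fun k hk => ?_
    rw [Finset.sum_add_distrib,
      sum_partsMerge_mergeRate p (Finset.mem_Icc.1 hj).1 (Finset.mem_Icc.1 hk).1,
      sum_partsMerge_splitRate p (Finset.mem_Icc.1 hj).1 (Finset.mem_Icc.1 hk).1]
  rw [Finset.sum_congr rfl this]
  simp only [Finset.sum_add_distrib]
  rw [sum_mergeRate, sum_splitRate]
  have h2 : ∑ m ∈ Finset.Icc 1 n, (m : ℝ) * (m - 1) * p.parts.count m =
      ∑ j ∈ Finset.Icc 1 n, (j : ℝ) ^ 2 * p.parts.count j - n := by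
    conv_rhs => rw [← p.sum_Icc_mul_count, ← Finset.sum_sub_distrib]
    exact Finset.sum_congr rfl fun m _ => by ring
  rw [h2]
  ring

/-- A function that is harmonic for the merge-split rates attains its maximum at the one-part
partition. -/
lemma le_indiscrete_of_harmonic {n : ℕ} (hn : 1 ≤ n) (f : n.Partition → ℝ)
    (hf : ∀ p, ∑ q, partsRate n p.parts q.parts * f q = n * (n - 1) * f p) (p : n.Partition) :
    f p ≤ f (Nat.Partition.indiscrete n) := by
  obtain ⟨m, -, hm⟩ := Finset.exists_max_image (Finset.univ : Finset n.Partition) f ⟨p, by simp⟩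
  have hm : ∀ q, f q ≤ f m := fun q => hm q (Finset.mem_univ q)
  have hstep : ∀ a b : n.Partition, f a = f m → 0 < partsRate n a.parts b.parts → f b = f m := by
    intro a b ha hab
    have hz : ∑ q, partsRate n a.parts q.parts * (f m - f q) = 0 := by
      simp only [mul_sub, Finset.sum_sub_distrib]
      rw [← Finset.sum_mul, sum_partsRate, hf, ha, sub_self]
    have := (Finset.sum_eq_zero_iff_of_nonneg fun q _ =>
      mul_nonneg (partsRate_nonneg n _ _) (sub_nonneg.2 (hm q))).1 hz b (Finset.mem_univ b)
    rcases mul_eq_zero.1 this with h | h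
    · exact absurd h hab.ne'
    · linarith
  have hmain : ∀ (c : ℕ) (a : n.Partition), a.parts.card = c → f a = f m →
      f (Nat.Partition.indiscrete n) = f m := by
    intro c
    induction c with
    | zero =>
      intro a ha _
      have := a.parts_sum
      rw [Multiset.card_eq_zero.1 ha] at this
      simp at this
      omega
    | succ c ih =>
      intro a ha hfa
      obtain ⟨j, hja⟩ : ∃ j, j ∈ a.parts :=
        Multiset.exists_mem_of_ne_zero (by rintro h; simp [h] at ha)
      obtain ⟨s, hs⟩ := Multiset.exists_cons_of_mem hja
      replace hs := hs.symm
      rcases Multiset.empty_or_exists_mem s with rfl | ⟨k, hk⟩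
      · have hjn : j = n := by
          rw [← a.parts_sum, ← hs]; simp
        have : a = Nat.Partition.indiscrete n := by
          apply Nat.Partition.ext
          rw [Nat.Partition.indiscrete_parts (by omega), ← hs, hjn]
          rfl
        rw [← this, hfa]
      · obtain ⟨u, rfl⟩ := Multiset.exists_cons_of_mem hk
        have hj : 0 < j := a.parts_pos (by rw [← hs]; simp)
        have hk : 0 < k := a.parts_pos (by rw [← hs]; simp)
        have hsum : ((j + k) ::ₘ u).sum = n := by
          rw [← a.parts_sum, ← hs]; simp [add_assoc]
        let b : n.Partition := ⟨(j + k) ::ₘ u, by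
          intro i hi
          rcases Multiset.mem_cons.1 hi with rfl | hi
          · omega
          · exact a.parts_pos (by rw [← hs]; simp [hi]), hsum⟩
        refine ih b ?_ (hstep a b hfa ?_)
        · rw [← hs] at ha
          simpa [b] using ha
        · rw [← hs]
          exact partsRate_pos_of_merge hj hk (b.le_of_mem_parts (by simp [b])) u
  rw [hmain _ m rfl rfl]
  exact hm p

lemma eq_indiscrete_of_harmonic {n : ℕ} (hn : 1 ≤ n) (f : n.Partition → ℝ)
    (hf : ∀ p, ∑ q, partsRate n p.parts q.parts * f q = n * (n - 1) * f p) (p : n.Partition) :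
    f p = f (Nat.Partition.indiscrete n) := by
  refine le_antisymm (le_indiscrete_of_harmonic hn f hf p) ?_
  have := le_indiscrete_of_harmonic hn (fun q => -f q) (fun p => by simp [hf]) p
  linarith

lemma Nat.Partition.parts_eq_replicate_add_filter {n : ℕ} (p : n.Partition) :
    p.parts = Multiset.replicate (p.parts.count 1) 1 + p.parts.filter (2 ≤ ·) := by
  ext q
  rw [Multiset.count_add, Multiset.count_replicate, Multiset.count_filter]
  rcases Nat.lt_or_ge q 2 with hq | hq
  · interval_cases q
    · have h0 : 0 ∉ p.parts := fun h => (p.parts_pos h).ne rfl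
      simp [h0]
    · simp
  · rw [if_pos hq, if_neg (by omega)]
    simp

lemma Nat.Partition.count_one_add_sum_filter {n : ℕ} (p : n.Partition) :
    p.parts.count 1 + (p.parts.filter (2 ≤ ·)).sum = n := by
  have := congrArg Multiset.sum p.parts_eq_replicate_add_filter
  rw [p.parts_sum, Multiset.sum_add, Multiset.sum_replicate] at this
  simpa using this.symm

lemma Nat.Partition.ext_filter {n : ℕ} {p q : n.Partition}
    (h : p.parts.filter (2 ≤ ·) = q.parts.filter (2 ≤ ·)) : p = q := by
  have hp := p.count_one_add_sum_filter
  have hq := q.count_one_add_sum_filter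
  rw [h] at hp
  apply Nat.Partition.ext
  rw [p.parts_eq_replicate_add_filter, q.parts_eq_replicate_add_filter, h,
    show p.parts.count 1 = q.parts.count 1 by omega]

lemma partsWeight_eq_filter {n : ℕ} (p : n.Partition) {m : Multiset ℕ}
    (hm : m = p.parts.filter (2 ≤ ·)) :
    partsWeight n p.parts = ((n - m.sum).factorial * m.prod *
      ∏ k ∈ m.toFinset, (m.count k).factorial : ℕ) := by
  have hsum := p.count_one_add_sum_filter
  rw [← hm] at hsum
  have hsub : p.parts.toFinset ⊆ Finset.Icc 1 n := by
    intro a ha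
    rw [Multiset.mem_toFinset] at ha
    exact Finset.mem_Icc.2 ⟨p.parts_pos ha, p.le_of_mem_parts ha⟩
  have hprod : p.parts.prod = m.prod := by
    rw [p.parts_eq_replicate_add_filter, ← hm]
    simp
  have hnot : 1 ∉ m.toFinset := by simp [hm]
  have hcount : ∀ k ∈ m.toFinset, (m.count k).factorial = (p.parts.count k).factorial := by
    intro k hk
    rw [Multiset.mem_toFinset, hm, Multiset.mem_filter] at hk
    rw [hm, Multiset.count_filter, if_pos hk.2]
  have hsub' : p.parts.toFinset ⊆ insert 1 m.toFinset := by
    intro a ha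
    rw [Multiset.mem_toFinset] at ha
    have := p.parts_pos ha
    rw [Finset.mem_insert, Multiset.mem_toFinset, hm, Multiset.mem_filter]
    by_cases h : a = 1
    · exact Or.inl h
    · exact Or.inr ⟨ha, by omega⟩
  have hone : ∀ k, k ∉ p.parts.toFinset → (p.parts.count k).factorial = 1 := by
    intro k hk
    rw [Multiset.mem_toFinset] at hk
    rw [Multiset.count_eq_zero_of_notMem hk, Nat.factorial_zero]
  have hfac : ∏ k ∈ Finset.Icc 1 n, (p.parts.count k).factorial =
      (n - m.sum).factorial * ∏ k ∈ m.toFinset, (m.count k).factorial := by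
    rw [show n - m.sum = p.parts.count 1 by omega, Finset.prod_congr rfl hcount,
      ← Finset.prod_insert (f := fun k => (p.parts.count k).factorial) hnot,
      ← Finset.prod_subset hsub fun k _ => hone k,
      ← Finset.prod_subset hsub' fun k _ => hone k]
  rw [mul_right_comm, ← hfac, ← hprod, Finset.prod_multiset_count_of_subset _ _ hsub]
  unfold partsWeight
  rw [Finset.prod_mul_distrib, mul_comm]
  push_cast
  rfl

open Equiv.Perm in
lemma card_partition_mul_partsWeight (α : Type*) [Fintype α] [DecidableEq α]
    (p : (Fintype.card α).Partition) :
    ((Finset.univ.filter fun g : Equiv.Perm α => g.partition = p).card : ℝ) *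
      partsWeight (Fintype.card α) p.parts = (Fintype.card α).factorial := by
  have hset : (Finset.univ.filter fun g : Equiv.Perm α => g.partition = p) =
      Finset.univ.filter fun g : Equiv.Perm α => g.cycleType = p.parts.filter (2 ≤ ·) := by
    ext g
    simp only [Finset.mem_filter, Finset.mem_univ, true_and]
    constructor
    · rintro rfl
      exact filter_parts_partition_eq_cycleType.symm
    · intro hg
      exact Nat.Partition.ext_filter (by rw [filter_parts_partition_eq_cycleType, hg])
  have hsum := p.count_one_add_sum_filter
  have hcard := card_of_cycleType_mul_eq α (p.parts.filter (2 ≤ ·))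
  rw [if_pos ⟨by omega, fun a ha => (Multiset.mem_filter.1 ha).2⟩] at hcard
  rw [hset, partsWeight_eq_filter p rfl]
  exact_mod_cast hcard

lemma sum_partsWeight_inv_card (α : Type*) [Fintype α] [DecidableEq α] :
    ∑ p : (Fintype.card α).Partition, (partsWeight (Fintype.card α) p.parts)⁻¹ = 1 := by
  have hfact : ((Fintype.card α).factorial : ℝ) ≠ 0 := by positivity
  have hterm : ∀ p : (Fintype.card α).Partition, (partsWeight (Fintype.card α) p.parts)⁻¹ =
      ((Finset.univ.filter fun g : Equiv.Perm α => g.partition = p).card : ℝ) /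
        (Fintype.card α).factorial := by
    intro p
    rw [inv_eq_one_div, div_eq_div_iff (partsWeight_pos _ _).ne' hfact, one_mul,
      card_partition_mul_partsWeight]
  simp only [hterm]
  rw [← Finset.sum_div, ← Nat.cast_sum, ← Finset.card_eq_sum_card_fiberwise (by simp),
    Finset.card_univ, Fintype.card_perm, div_self hfact]

lemma sum_partsWeight_inv (n : ℕ) : ∑ p : n.Partition, (partsWeight n p.parts)⁻¹ = 1 := by
  have h := sum_partsWeight_inv_card (Fin n)
  rwa [Fintype.card_fin] at h

lemma PartN.support_finite {n : ℕ} {l : ℕ → ℕ} (hl : l ∈ PartN n) : {i | l i ≠ 0}.Finite := by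
  have h := ENNReal.finite_const_le_of_tsum_ne_top (a := fun i => (l i : ℝ≥0∞))
    (by rw [hl.2]; exact ENNReal.natCast_ne_top n) one_ne_zero
  refine h.subset fun i hi => ?_
  have : 1 ≤ l i := Nat.one_le_iff_ne_zero.2 hi
  show (1 : ℝ≥0∞) ≤ (l i : ℝ≥0∞)
  exact_mod_cast this

lemma PartN.support_eq_Iio {n : ℕ} {l : ℕ → ℕ} (hl : l ∈ PartN n) :
    {i | l i ≠ 0} = Set.Iio (numParts l) := by
  have hfin := PartN.support_finite hl
  obtain ⟨m, hm⟩ : ∃ m, {i | l i ≠ 0} = Set.Iio m := by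
    have hex : ∃ i, l i = 0 := by
      by_contra! h
      exact Set.infinite_univ (hfin.subset fun i _ => h i)
    classical
    refine ⟨Nat.find hex, Set.ext fun i => ⟨fun hi => ?_, fun hi => Nat.find_min hex hi⟩⟩
    by_contra hlt
    have := hl.1 (not_lt.1 hlt : Nat.find hex ≤ i)
    rw [Nat.find_spec hex] at this
    exact hi (by omega)
  have : numParts l = m := by
    unfold numParts
    rw [hm]
    simp
  rw [this, hm]

lemma PartN.ne_zero_iff {n : ℕ} {l : ℕ → ℕ} (hl : l ∈ PartN n) (i : ℕ) :
    l i ≠ 0 ↔ i < numParts l :=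
  Set.ext_iff.1 (PartN.support_eq_Iio hl) i

/-- The multiset of nonzero parts of an element of `𝒫ₙ`. -/
def partsOf (l : ℕ → ℕ) : Multiset ℕ := ((List.range (numParts l)).map l : List ℕ)

lemma PartN.partsOf_sum {n : ℕ} {l : ℕ → ℕ} (hl : l ∈ PartN n) : (partsOf l).sum = n := by
  have h : ∑' i, (l i : ℝ≥0∞) = ∑ i ∈ Finset.range (numParts l), (l i : ℝ≥0∞) := by
    refine tsum_eq_sum fun i hi => ?_
    have := (PartN.ne_zero_iff hl i).not.2 (by simpa using hi)
    exact_mod_cast not_not.1 this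
  have h2 : ((∑ i ∈ Finset.range (numParts l), l i : ℕ) : ℝ≥0∞) = n := by
    rw [← hl.2, h]
    push_cast
    rfl
  rw [← Nat.cast_injective h2]
  rfl

lemma PartN.typeCount_eq {n : ℕ} {l : ℕ → ℕ} (hl : l ∈ PartN n) (k : ℕ) :
    typeCount l k = (partsOf l).count k := by
  rcases Nat.eq_zero_or_pos k with rfl | hk
  · have hinf : {i | l i = 0}.Infinite := by
      have := (PartN.support_finite hl).infinite_compl
      convert this using 1
      ext i
      simp
    have : 0 ∉ partsOf l := by
      simp only [partsOf, Multiset.mem_coe, List.mem_map, List.mem_range, not_exists, not_and]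
      exact fun i hi => (PartN.ne_zero_iff hl i).2 hi
    rw [Multiset.count_eq_zero_of_notMem this]
    exact hinf.card_eq_zero
  · have hset : {i | l i = k} = ((Finset.range (numParts l)).filter (l · = k) : Set ℕ) := by
      ext i
      simp only [Set.mem_ofPred_eq, Finset.coe_filter, Finset.mem_range]
      refine ⟨fun h => ⟨(PartN.ne_zero_iff hl i).1 (by omega), h⟩, fun h => h.2⟩
    unfold typeCount
    rw [hset]
    have : partsOf l = (Multiset.range (numParts l)).map l := rfl
    rw [this, Multiset.count_map, Nat.card_eq_card_toFinset]
    simp only [Finset.toFinset_coe, Finset.card_def, Finset.filter_val, Finset.range_val, eq_comm]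

lemma PartN.sort_partsOf {n : ℕ} {l : ℕ → ℕ} (hl : l ∈ PartN n) :
    (partsOf l).sort (· ≥ ·) = (List.range (numParts l)).map l := by
  refine List.Perm.eq_of_pairwise' (r := (· ≥ ·)) (Multiset.pairwise_sort _ _) ?_ ?_
  · rw [List.pairwise_map]
    exact List.pairwise_lt_range.imp fun h => hl.1 h.le
  · rw [← Multiset.coe_eq_coe, Multiset.sort_eq]
    rfl

/-- The nonincreasing sequence listing a multiset of parts, padded with zeros. -/
def seqOf (s : Multiset ℕ) (i : ℕ) : ℕ := (s.sort (· ≥ ·)).getD i 0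

lemma PartN.seqOf_partsOf {n : ℕ} {l : ℕ → ℕ} (hl : l ∈ PartN n) : seqOf (partsOf l) = l := by
  funext i
  unfold seqOf
  rw [PartN.sort_partsOf hl, List.getD_eq_getElem?_getD]
  rcases Nat.lt_or_ge i (numParts l) with hi | hi
  · simp [hi]
  · have := (PartN.ne_zero_iff hl i).not.2 (by omega)
    simp [hi, not_not.1 this]

lemma seqOf_antitone (s : Multiset ℕ) : Antitone (seqOf s) := by
  intro i j hij
  unfold seqOf
  rcases Nat.lt_or_ge j (s.sort (· ≥ ·)).length with hj | hj
  · rw [List.getD_eq_getElem _ _ hj, List.getD_eq_getElem _ _ (hij.trans_lt hj)]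
    exact (Multiset.pairwise_sort s (· ≥ ·)).rel_get_of_le (a := ⟨i, hij.trans_lt hj⟩)
      (b := ⟨j, hj⟩) hij
  · rw [List.getD_eq_default _ _ hj]
    exact Nat.zero_le _

lemma map_range_seqOf (s : Multiset ℕ) :
    (List.range s.card).map (seqOf s) = s.sort (· ≥ ·) := by
  apply List.ext_getElem
  · simp
  · intro i h1 h2
    simp only [List.getElem_map, List.getElem_range, seqOf]
    rw [List.getD_eq_getElem _ _ h2]

lemma numParts_seqOf {s : Multiset ℕ} (hs : ∀ i ∈ s, 0 < i) : numParts (seqOf s) = s.card := by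
  have : {i | seqOf s i ≠ 0} = Set.Iio s.card := by
    ext i
    simp only [Set.mem_ofPred_eq, Set.mem_Iio]
    rw [← Multiset.length_sort (r := (· ≥ ·)) (s := s)]
    unfold seqOf
    constructor
    · intro h
      by_contra hi
      exact h (List.getD_eq_default _ _ (not_lt.1 hi))
    · intro h
      rw [List.getD_eq_getElem _ _ h]
      exact (hs _ ((Multiset.mem_sort _).1 (List.getElem_mem h))).ne'
  unfold numParts
  rw [this]
  simp

lemma partsOf_seqOf {s : Multiset ℕ} (hs : ∀ i ∈ s, 0 < i) : partsOf (seqOf s) = s := by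
  unfold partsOf
  rw [numParts_seqOf hs, map_range_seqOf, Multiset.sort_eq]

lemma seqOf_mem_PartN {n : ℕ} (p : n.Partition) : seqOf p.parts ∈ PartN n := by
  refine ⟨seqOf_antitone _, ?_⟩
  have h : ∑' i, (seqOf p.parts i : ℝ≥0∞) =
      ∑ i ∈ Finset.range p.parts.card, (seqOf p.parts i : ℝ≥0∞) := by
    refine tsum_eq_sum fun i hi => ?_
    have : seqOf p.parts i = 0 :=
      List.getD_eq_default _ _ (by rw [Multiset.length_sort]; simpa using hi)
    exact_mod_cast this
  rw [h, ← Nat.cast_sum]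
  congr 1
  have h2 := congrArg Multiset.sum (partsOf_seqOf fun i (hi : i ∈ p.parts) => p.parts_pos hi)
  rw [partsOf, numParts_seqOf fun i (hi : i ∈ p.parts) => p.parts_pos hi, p.parts_sum] at h2
  exact h2

/-- Partitions as nonincreasing sequences correspond to partitions as multisets. -/
def partNEquiv (n : ℕ) : PartN n ≃ n.Partition where
  toFun l := ⟨partsOf l.1, by
    intro i hi
    simp only [partsOf, Multiset.mem_coe, List.mem_map, List.mem_range] at hi
    obtain ⟨a, ha, rfl⟩ := hi
    exact Nat.pos_of_ne_zero ((PartN.ne_zero_iff l.2 a).2 ha), PartN.partsOf_sum l.2⟩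
  invFun p := ⟨seqOf p.parts, seqOf_mem_PartN p⟩
  left_inv l := Subtype.ext (PartN.seqOf_partsOf l.2)
  right_inv p := Nat.Partition.ext (partsOf_seqOf fun _ hi => p.parts_pos hi)

lemma typeCount_eq_count {n : ℕ} (l : PartN n) (k : ℕ) :
    typeCount l k = (partNEquiv n l).parts.count k :=
  PartN.typeCount_eq l.2 k

lemma ewens_eq_partsWeight_inv {n : ℕ} (l : PartN n) :
    ewens n l = (partsWeight n (partNEquiv n l).parts)⁻¹ := by
  simp only [ewens, partsWeight, typeCount_eq_count]

lemma mergeRel_iff {n j k : ℕ} (hj : 1 ≤ j) (hjk : j < k) (l l' : PartN n) :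
    MergeRel j k l l' ↔ PartsMerge j k (partNEquiv n l).parts (partNEquiv n l').parts := by
  simp only [MergeRel, PartsMerge, typeCount_eq_count, Multiset.ext, Multiset.count_add,
    Multiset.insert_eq_cons, Multiset.count_cons, Multiset.count_singleton,
    Set.mem_insert_iff, Set.mem_singleton_iff, not_or]
  generalize (partNEquiv n l).parts = s
  generalize (partNEquiv n l').parts = t
  constructor
  · rintro ⟨h1, h2, h3, h4⟩ q
    by_cases hqj : q = j
    · subst hqj; split_ifs <;> omega
    by_cases hqk : q = k
    · subst hqk; split_ifs <;> omega
    by_cases hq : q = j + k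
    · subst hq; split_ifs <;> omega
    have := h4 q ⟨hqj, hqk, hq⟩
    split_ifs; omega
  · intro h
    refine ⟨?_, ?_, ?_, fun q hq => ?_⟩
    · have := h j; split_ifs at this <;> omega
    · have := h k; split_ifs at this <;> omega
    · have := h (j + k); split_ifs at this <;> omega
    · have := h q; simpa [hq.1, hq.2.1, hq.2.2] using this.symm

lemma eqMergeRel_iff {n j : ℕ} (hj : 1 ≤ j) (l l' : PartN n) :
    EqMergeRel j l l' ↔ PartsMerge j j (partNEquiv n l).parts (partNEquiv n l').parts := by
  simp only [EqMergeRel, PartsMerge, typeCount_eq_count, Multiset.ext, Multiset.count_add,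
    Multiset.insert_eq_cons, Multiset.count_cons, Multiset.count_singleton,
    Set.mem_insert_iff, Set.mem_singleton_iff, not_or, ← two_mul]
  generalize (partNEquiv n l).parts = s
  generalize (partNEquiv n l').parts = t
  constructor
  · rintro ⟨h1, h3, h4⟩ q
    by_cases hqj : q = j
    · subst hqj; split_ifs <;> omega
    by_cases hq : q = 2 * j
    · subst hq; split_ifs <;> omega
    have := h4 q ⟨hqj, hq⟩
    simpa [hqj, hq] using this.symm
  · intro h
    refine ⟨?_, ?_, fun q hq => ?_⟩
    · have := h j; split_ifs at this <;> omega
    · have := h (2 * j); split_ifs at this <;> omega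
    · have := h q; simpa [hq.1, hq.2] using this.symm

lemma PartsMerge.comm {j k : ℕ} {s t : Multiset ℕ} : PartsMerge j k s t ↔ PartsMerge k j s t := by
  unfold PartsMerge
  rw [add_comm j k, Multiset.pair_comm]

lemma mergeRate_comm (j k : ℕ) (s : Multiset ℕ) : mergeRate j k s = mergeRate k j s := by
  rcases eq_or_ne j k with rfl | h
  · rfl
  · rw [mergeRate, mergeRate, Multiset.count_erase_of_ne h, Multiset.count_erase_of_ne h.symm]
    ring

lemma splitRate_comm (j k : ℕ) (s : Multiset ℕ) : splitRate j k s = splitRate k j s := by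
  rw [splitRate, splitRate, add_comm j k, add_comm (j : ℝ)]

/-- A symmetric double sum is twice the sum below the diagonal plus the diagonal sum. -/
lemma Finset.sum_sum_eq_of_symm (s : Finset ℕ) (F : ℕ → ℕ → ℝ) (hF : ∀ j k, F j k = F k j) :
    ∑ j ∈ s, ∑ k ∈ s, F j k =
      ∑ j ∈ s, ∑ k ∈ s, (if j < k then 2 * F j k else 0) + ∑ j ∈ s, F j j := by
  have h1 : ∀ j k, F j k = (if j < k then F j k else 0) + (if k < j then F k j else 0) +
      (if k = j then F j j else 0) := by
    intro j k
    rcases lt_trichotomy j k with h | rfl | h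
    · simp [h, h.not_gt, h.ne']
    · simp
    · simp [h, h.not_gt, h.ne, hF j k]
  have h2 : ∑ j ∈ s, ∑ k ∈ s, (if k < j then F k j else 0) =
      ∑ j ∈ s, ∑ k ∈ s, (if j < k then F j k else 0) := Finset.sum_comm
  calc ∑ j ∈ s, ∑ k ∈ s, F j k
      = ∑ j ∈ s, ∑ k ∈ s, ((if j < k then F j k else 0) + (if k < j then F k j else 0) +
          (if k = j then F j j else 0)) :=
        Finset.sum_congr rfl fun j _ => Finset.sum_congr rfl fun k _ => h1 j k
    _ = _ := by
        simp only [Finset.sum_add_distrib, h2]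
        congr 1
        · rw [← two_mul, Finset.mul_sum]
          refine Finset.sum_congr rfl fun j _ => ?_
          rw [Finset.mul_sum]
          exact Finset.sum_congr rfl fun k _ => by split_ifs <;> simp
        · exact Finset.sum_congr rfl fun j hj => by rw [Finset.sum_ite_eq', if_pos hj]

lemma Kmat_eq_partsRate {n : ℕ} (l l' : PartN n) :
    Kmat n l l' =
      partsRate n (partNEquiv n l).parts (partNEquiv n l').parts / (n * (n - 1)) := by
  have hsub : Finset.Icc 1 n ⊆ Finset.range (n + 1) := by
    intro j hj
    simp only [Finset.mem_Icc, Finset.mem_range] at hj ⊢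
    omega
  have hzero : ∀ j ∈ Finset.range (n + 1), j ∉ Finset.Icc 1 n → ¬ 1 ≤ j := by
    intro j hj hj'
    simp only [Finset.mem_Icc, Finset.mem_range] at hj hj'
    omega
  have hdouble : ∀ (s t : PartN n) (j : ℕ), 1 ≤ j →
      PartsMerge j j (partNEquiv n s).parts (partNEquiv n t).parts → 2 * j ≤ n := by
    intro s t j hj h
    obtain ⟨u, -, hu⟩ := h.exists_eq_cons hj hj
    have := (partNEquiv n t).le_of_mem_parts (m := j + j) (by rw [hu]; simp)
    omega
  unfold partsRate
  rw [Finset.sum_sum_eq_of_symm _ _ fun j k => by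
    simp only [PartsMerge.comm (j := j), mergeRate_comm j, splitRate_comm j]]
  unfold Kmat
  rw [add_div]
  congr 1
  · rw [Finset.sum_div, ← Finset.sum_subset hsub fun j hj hj' => by simp [hzero j hj hj']]
    refine Finset.sum_congr rfl fun j hj => ?_
    have hj := (Finset.mem_Icc.1 hj).1
    rw [Finset.sum_div, ← Finset.sum_subset hsub fun k hk hk' => by
      have : ¬ j < k := fun h => hzero k hk hk' (by omega)
      simp [this]]
    refine Finset.sum_congr rfl fun k _ => ?_
    by_cases hjk : j < k
    · simp only [hj, hjk, true_and, if_true, mergeRel_iff hj hjk, mul_add, add_div]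
      congr 1
      · split_ifs
        · rw [mergeRate, Multiset.count_erase_of_ne hjk.ne', typeCount_eq_count,
            typeCount_eq_count]
          ring
        · simp
      · split_ifs
        · rw [splitRate, typeCount_eq_count]
          ring
        · simp
    · simp [hjk]
  · rw [Finset.sum_div, ← Finset.sum_subset hsub fun j hj hj' => by simp [hzero j hj hj']]
    refine Finset.sum_congr rfl fun j hj => ?_
    have hj := (Finset.mem_Icc.1 hj).1
    have hiff : ∀ s t : PartN n, (1 ≤ j ∧ 2 * j ≤ n ∧ EqMergeRel j s t) ↔
        PartsMerge j j (partNEquiv n s).parts (partNEquiv n t).parts := by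
      intro s t
      rw [eqMergeRel_iff hj]
      exact ⟨fun h => h.2.2, fun h => ⟨hj, hdouble s t j hj h, h⟩⟩
    simp only [hiff, add_div]
    congr 1
    · split_ifs
      · rw [mergeRate, Multiset.count_erase_self, typeCount_eq_count]
        by_cases hc : (partNEquiv n l).parts.count j = 0
        · simp [hc]
        · rw [Nat.cast_sub (by omega)]
          push_cast
          ring
      · simp
    · split_ifs
      · rw [splitRate, typeCount_eq_count, two_mul j]
        ring
      · simp

/-- **Uniqueness of the DCF stationary law**: for `n ≥ 2`, the Ewens measure
`π_S⁽ⁿ⁾` is a stationary probability vector of `K⁽ⁿ⁾`, and any stationary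
probability vector on `𝒫ₙ` equals `π_S⁽ⁿ⁾`. -/
theorem ewens_unique_stationary (n : ℕ) (hn : 2 ≤ n) :
    ((∀ l ∈ PartN n, 0 ≤ ewens n l) ∧ (∑' l : PartN n, ewens n l) = 1 ∧
      (∀ l' ∈ PartN n, ∑' l : PartN n, ewens n l * Kmat n l l' = ewens n l')) ∧
    (∀ π : (ℕ → ℕ) → ℝ, (∀ l, 0 ≤ π l) → (∀ l, π l ≠ 0 → l ∈ PartN n) →
      (∑' l : PartN n, π l) = 1 →
      (∀ l' ∈ PartN n, ∑' l : PartN n, π l * Kmat n l l' = π l') →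
      ∀ l ∈ PartN n, π l = ewens n l) := by
  have htsum : ∀ g : PartN n → ℝ, ∑' l : PartN n, g l =
      ∑ p : n.Partition, g ((partNEquiv n).symm p) := by
    intro g
    rw [← (partNEquiv n).symm.tsum_eq g, tsum_fintype]
  have hn' : (2 : ℝ) ≤ n := by exact_mod_cast hn
  have hc : (n : ℝ) * (n - 1) ≠ 0 := by
    have : (0 : ℝ) < n * (n - 1) := mul_pos (by linarith) (by linarith)
    exact this.ne'
  have hone : (∑' l : PartN n, ewens n l) = 1 := by
    rw [htsum]
    simp only [ewens_eq_partsWeight_inv, Equiv.apply_symm_apply]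
    exact sum_partsWeight_inv n
  refine ⟨⟨fun l hl => ?_, hone, fun l' hl' => ?_⟩, ?_⟩
  · rw [ewens_eq_partsWeight_inv ⟨l, hl⟩]
    exact inv_nonneg.2 (partsWeight_pos _ _).le
  · rw [htsum]
    have hK := fun p => Kmat_eq_partsRate ((partNEquiv n).symm p) ⟨l', hl'⟩
    simp only [ewens_eq_partsWeight_inv, Equiv.apply_symm_apply] at hK ⊢
    simp only [hK, ewens_eq_partsWeight_inv ⟨l', hl'⟩, ← mul_div_assoc,
      partsRate_detailed_balance _ (partNEquiv n ⟨l', hl'⟩)]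
    rw [← Finset.sum_div, ← Finset.mul_sum, sum_partsRate, mul_div_cancel_right₀ _ hc]
  · intro π _ _ hπ1 hπ l hl
    set f : n.Partition → ℝ := fun p => π ((partNEquiv n).symm p) * partsWeight n p.parts with hf
    have hπf : ∀ p : n.Partition,
        π ((partNEquiv n).symm p) = f p * (partsWeight n p.parts)⁻¹ := by
      intro p
      rw [hf, mul_inv_cancel_right₀ (partsWeight_pos _ _).ne']
    have hharm : ∀ p, ∑ q, partsRate n p.parts q.parts * f q = n * (n - 1) * f p := by
      intro p
      have h := hπ _ ((partNEquiv n).symm p).2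
      rw [htsum] at h
      simp only [Kmat_eq_partsRate, Equiv.apply_symm_apply, hπf, mul_assoc, ← mul_div_assoc,
        partsRate_detailed_balance _ p] at h
      rw [← Finset.sum_div, div_eq_iff hc] at h
      have hw := (partsWeight_pos n p.parts).ne'
      have h2 : ∑ q, partsRate n p.parts q.parts * f q =
          partsWeight n p.parts *
            ∑ q, f q * ((partsWeight n p.parts)⁻¹ * partsRate n p.parts q.parts) := by
        rw [Finset.mul_sum]
        refine Finset.sum_congr rfl fun q _ => ?_
        field_simp
      rw [h2, h]
      field_simp
    have hconst := eq_indiscrete_of_harmonic (by omega) f hharm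
    have hval : f (Nat.Partition.indiscrete n) = 1 := by
      rw [htsum] at hπ1
      simp only [hπf, hconst] at hπ1
      rwa [← Finset.mul_sum, sum_partsWeight_inv, mul_one] at hπ1
    have := hπf (partNEquiv n ⟨l, hl⟩)
    rw [Equiv.symm_apply_apply, hconst, hval, one_mul] at this
    rw [ewens_eq_partsWeight_inv ⟨l, hl⟩]
    exact this

end
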